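/- arXiv:2410.04156 — 3 statements merged into one kernel-verified Lean document; each statement's English description precedes it below -/
import Mathlib

section
/- For every k ∈ {0,1,...,n} and every t ≥ 0, the function h_k(x) = P[X_{t+1} ≥ k | X_t = x] is nondecreasing in x on {0,1,...,n}. Equivalently: for x ≤ x' in {0,...,n}, if Y ~ Binomial(n−x, p) and Y' ~ Binomial(n−x', p), then P[x + Y − min(x + Y, K) ≥ k] ≤ P[x' + Y' − min(x' + Y', K) ≥ k]. -/
/-- The probability mass function of a `Binomial(m, p)` random variable at `k`. -/
noncomputable def binomPMF (m : ℕ) (p : ℝ) (k : ℕ) : ℝ :=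
  (m.choose k : ℝ) * p ^ k * (1 - p) ^ (m - k)

/-- One-step transition probability of the error Markov chain on `{0, ..., n}`:
from state `x`, draw `Y ~ Binomial(n − x, p)` and move to `x + Y − min (x + Y) K`. -/
noncomputable def stepProb (n K : ℕ) (p : ℝ) (x y : ℕ) : ℝ :=
  ∑ yv ∈ Finset.range (n - x + 1),
    if x + yv - min (x + yv) K = y then binomPMF (n - x) p yv else 0

/-- `m`-step transition probability of the error Markov chain. -/
noncomputable def iterProb (n K : ℕ) (p : ℝ) : ℕ → ℕ → ℕ → ℝ
  | 0 => fun x y => if x = y then 1 else 0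
  | (m + 1) => fun x y =>
      ∑ z ∈ Finset.range (n + 1), stepProb n K p x z * iterProb n K p m z y

/-- Pascal recursion for the binomial mass function. -/
lemma binomPMF_succ_succ (m : ℕ) (p : ℝ) (j : ℕ) :
    binomPMF (m + 1) p (j + 1) = p * binomPMF m p j + (1 - p) * binomPMF m p (j + 1) := by
  unfold binomPMF
  rw [Nat.choose_succ_succ]
  rcases Nat.lt_or_ge m (j + 1) with h | h
  · rw [Nat.choose_eq_zero_of_lt h]
    have : m + 1 - (j + 1) = m - j := by omega
    rw [this]
    push_cast
    ring
  · obtain ⟨d, rfl⟩ := Nat.exists_eq_add_of_le h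
    have h1 : j + 1 + d + 1 - (j + 1) = d + 1 := by omega
    have h2 : j + 1 + d - j = d + 1 := by omega
    have h3 : j + 1 + d - (j + 1) = d := by omega
    rw [h1, h2, h3]
    push_cast
    ring

lemma binomPMF_nonneg (m : ℕ) (p : ℝ) (hp0 : 0 < p) (hp1 : p < 1) (j : ℕ) :
    0 ≤ binomPMF m p j := by
  unfold binomPMF
  have : 0 ≤ 1 - p := by linarith
  positivity

/-- Conditioning on one trial of the binomial. -/
lemma binom_expect_succ (m : ℕ) (p : ℝ) (f : ℕ → ℝ) :
    ∑ j ∈ Finset.range (m + 1 + 1), binomPMF (m + 1) p j * f j =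
      p * ∑ j ∈ Finset.range (m + 1), binomPMF m p j * f (j + 1) +
      (1 - p) * ∑ j ∈ Finset.range (m + 1), binomPMF m p j * f j := by
  have h0 : binomPMF (m + 1) p 0 = (1 - p) * binomPMF m p 0 := by
    simp [binomPMF, pow_succ, mul_comm]
  have hz : binomPMF m p (m + 1) = 0 := by simp [binomPMF]
  have e : ∑ j ∈ Finset.range (m + 1), binomPMF m p j * f j =
      ∑ j ∈ Finset.range (m + 1), binomPMF m p (j + 1) * f (j + 1) + binomPMF m p 0 * f 0 := by
    rw [← Finset.sum_range_succ' (fun j => binomPMF m p j * f j), Finset.sum_range_succ _ (m + 1),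
      hz]
    simp
  rw [e, Finset.sum_range_succ', h0, mul_add, Finset.mul_sum, Finset.mul_sum, ← add_assoc,
    ← Finset.sum_add_distrib]
  congr 1
  · refine Finset.sum_congr rfl fun j _ => ?_
    rw [binomPMF_succ_succ]
    ring
  · ring

lemma tail_eq (n K : ℕ) (p : ℝ) (k x : ℕ) (hx : x ≤ n) :
    (∑ y ∈ Finset.range (n + 1), if k ≤ y then stepProb n K p x y else 0) =
      ∑ j ∈ Finset.range (n - x + 1), binomPMF (n - x) p j *
        (if k ≤ (x + j) - min (x + j) K then 1 else 0) := by
  have : ∀ y, (if k ≤ y then stepProb n K p x y else 0) =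
      ∑ j ∈ Finset.range (n - x + 1), if x + j - min (x + j) K = y then
        (if k ≤ y then binomPMF (n - x) p j else 0) else 0 := by
    intro y
    unfold stepProb
    split_ifs <;> simp
  simp_rw [this]
  rw [Finset.sum_comm]
  refine Finset.sum_congr rfl fun j hj => ?_
  rw [Finset.sum_ite_eq, if_pos]
  · simp
  · simp only [Finset.mem_range] at hj ⊢
    omega

/-- For every `k ∈ {0, ..., n}`, the one-step tail transition probability
`h_k(x) = P[X_{t+1} ≥ k ∣ X_t = x]` of the error Markov chain is nondecreasing in the
state `x` on `{0, ..., n}` (the chain is time-homogeneous, so this probability does not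
depend on `t`). -/
theorem one_step_tail_monotone (n K : ℕ) (hn : 0 < n) (p : ℝ) (hp0 : 0 < p) (hp1 : p < 1)
    (hK : K ≤ n) (k : ℕ) (hk : k ≤ n) (x x' : ℕ) (hxx' : x ≤ x') (hx' : x' ≤ n) :
    (∑ y ∈ Finset.range (n + 1), if k ≤ y then stepProb n K p x y else 0) ≤
      ∑ y ∈ Finset.range (n + 1), if k ≤ y then stepProb n K p x' y else 0 := by
  have key : ∀ z, z + 1 ≤ n →
      (∑ y ∈ Finset.range (n + 1), if k ≤ y then stepProb n K p z y else 0) ≤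
      ∑ y ∈ Finset.range (n + 1), if k ≤ y then stepProb n K p (z + 1) y else 0 := by
    intro z hz
    rw [tail_eq n K p k z (by omega), tail_eq n K p k (z + 1) hz]
    obtain ⟨m, hm⟩ : ∃ m, n - z = m + 1 := ⟨n - z - 1, by omega⟩
    have hm' : n - (z + 1) = m := by omega
    rw [hm, hm', binom_expect_succ m p
      (fun j => if k ≤ (z + j) - min (z + j) K then (1 : ℝ) else 0)]
    have e : ∀ j, z + (j + 1) = z + 1 + j := fun j => by omega
    rw [Finset.sum_congr rfl (fun j _ => by rw [e j] : ∀ j ∈ Finset.range (m + 1), binomPMF m p j *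
        (if k ≤ (z + (j + 1)) - min (z + (j + 1)) K then (1 : ℝ) else 0) = binomPMF m p j *
        (if k ≤ (z + 1 + j) - min (z + 1 + j) K then (1 : ℝ) else 0))]
    have hle : ∑ j ∈ Finset.range (m + 1), binomPMF m p j *
          (if k ≤ (z + j) - min (z + j) K then (1 : ℝ) else 0) ≤
        ∑ j ∈ Finset.range (m + 1), binomPMF m p j *
          (if k ≤ (z + 1 + j) - min (z + 1 + j) K then (1 : ℝ) else 0) := by
      refine Finset.sum_le_sum fun j _ =>
        mul_le_mul_of_nonneg_left ?_ (binomPMF_nonneg m p hp0 hp1 j)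
      split_ifs with h1 h2
      · exact le_rfl
      · exfalso
        omega
      · exact zero_le_one
      · exact le_rfl
    nlinarith [mul_le_mul_of_nonneg_left hle (by linarith : (0 : ℝ) ≤ 1 - p)]
  induction x', hxx' using Nat.le_induction with
  | base => exact le_rfl
  | succ z hz ih => exact (ih (by omega)).trans (key z hx')
end

section
/- For every integer m ≥ 1, every k ∈ {0,1,...,n}, and every t ≥ 0, the function h_k^{(m)}(x) = P[X_{t+m} ≥ k | X_t = x] is nondecreasing in x on {0,1,...,n}. -/
theorem binom_rec (N : ℕ) (p : ℝ) (g : ℕ → ℝ) :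
    ∑ j ∈ Finset.range (N + 1 + 1), binomPMF (N + 1) p j * g j =
      (1 - p) * ∑ j ∈ Finset.range (N + 1), binomPMF N p j * g j +
      p * ∑ j ∈ Finset.range (N + 1), binomPMF N p j * g (j + 1) := by
  have h2 : (1 - p) * ∑ j ∈ Finset.range (N + 1), binomPMF N p j * g j =
      ∑ j ∈ Finset.range (N + 1 + 1),
        (N.choose j : ℝ) * p ^ j * (1 - p) ^ (N + 1 - j) * g j := by
    rw [Finset.sum_range_succ _ (N + 1), Nat.choose_succ_self, Finset.mul_sum]
    simp only [Nat.cast_zero, zero_mul, add_zero]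
    refine Finset.sum_congr rfl fun j hj => ?_
    have hj' : j ≤ N := by simpa [Nat.lt_succ_iff] using hj
    rw [Nat.succ_sub hj', pow_succ, binomPMF]
    ring
  rw [h2, Finset.sum_range_succ', Finset.sum_range_succ' _ (N + 1), Finset.mul_sum,
    add_right_comm, ← Finset.sum_add_distrib]
  congr 1
  · refine Finset.sum_congr rfl fun j hj => ?_
    simp only [binomPMF, Nat.choose_succ_succ, Nat.add_sub_add_right, Nat.cast_add]
    ring
  · simp [binomPMF]

theorem binom_nonneg (N : ℕ) (p : ℝ) (hp0 : 0 < p) (hp1 : p < 1) (j : ℕ) :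
    0 ≤ binomPMF N p j := by
  have : 0 < 1 - p := by linarith
  unfold binomPMF
  positivity

theorem step_exp (n K : ℕ) (p : ℝ) (f : ℕ → ℝ) (x : ℕ) (hx : x ≤ n) :
    ∑ z ∈ Finset.range (n + 1), stepProb n K p x z * f z =
      ∑ j ∈ Finset.range (n - x + 1), binomPMF (n - x) p j * f (x + j - min (x + j) K) := by
  simp only [stepProb, Finset.sum_mul]
  rw [Finset.sum_comm]
  refine Finset.sum_congr rfl fun j hj => ?_
  have hj' : j < n - x + 1 := by simpa using hj
  simp only [ite_mul, zero_mul]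
  rw [Finset.sum_ite_eq, if_pos]
  simp only [Finset.mem_range]
  omega

theorem step_mono (n K : ℕ) (p : ℝ) (hp0 : 0 < p) (hp1 : p < 1) (f : ℕ → ℝ)
    (hf : ∀ a b, a ≤ b → b ≤ n → f a ≤ f b) (x : ℕ) (hx : x + 1 ≤ n) :
    ∑ z ∈ Finset.range (n + 1), stepProb n K p x z * f z ≤
      ∑ z ∈ Finset.range (n + 1), stepProb n K p (x + 1) z * f z := by
  rw [step_exp _ _ _ _ _ (by omega), step_exp _ _ _ _ _ hx]
  obtain ⟨N, rfl⟩ := Nat.exists_eq_add_of_le hx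
  have e1 : x + 1 + N - x = N + 1 := by omega
  have e2 : x + 1 + N - (x + 1) = N := by omega
  rw [e1, e2, binom_rec N p (fun j => f (x + j - min (x + j) K))]
  have e3 : ∀ j, x + 1 + j = x + (j + 1) := fun j => by omega
  have e4 : ∑ j ∈ Finset.range (N + 1), binomPMF N p j * f (x + 1 + j - min (x + 1 + j) K) =
      ∑ j ∈ Finset.range (N + 1), binomPMF N p j * f (x + (j + 1) - min (x + (j + 1)) K) :=
    Finset.sum_congr rfl fun j _ => by rw [e3 j]
  have key : ∑ j ∈ Finset.range (N + 1), binomPMF N p j * f (x + j - min (x + j) K) ≤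
      ∑ j ∈ Finset.range (N + 1), binomPMF N p j * f (x + 1 + j - min (x + 1 + j) K) := by
    refine Finset.sum_le_sum fun j hj => ?_
    have hj' : j < N + 1 := by simpa using hj
    exact mul_le_mul_of_nonneg_left (hf _ _ (by omega) (by omega)) (binom_nonneg N p hp0 hp1 j)
  have := mul_le_mul_of_nonneg_left key (by linarith : 0 ≤ 1 - p)
  rw [e4] at this ⊢
  linarith

theorem tail_succ (n K : ℕ) (p : ℝ) (m k x : ℕ) :
    (∑ y ∈ Finset.range (n + 1), if k ≤ y then iterProb n K p (m + 1) x y else 0) =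
      ∑ z ∈ Finset.range (n + 1), stepProb n K p x z *
        ∑ y ∈ Finset.range (n + 1), if k ≤ y then iterProb n K p m z y else 0 := by
  simp only [Finset.mul_sum]
  rw [Finset.sum_comm]
  refine Finset.sum_congr rfl fun y _ => ?_
  split_ifs <;> simp [iterProb]

theorem tail_mono (n K : ℕ) (p : ℝ) (hp0 : 0 < p) (hp1 : p < 1) (k m : ℕ) :
    ∀ a b, a ≤ b → b ≤ n →
    (∑ y ∈ Finset.range (n + 1), if k ≤ y then iterProb n K p m a y else 0) ≤
      ∑ y ∈ Finset.range (n + 1), if k ≤ y then iterProb n K p m b y else 0 := by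
  induction m with
  | zero =>
    intro a b hab hb
    have h : ∀ c, c ≤ n → (∑ y ∈ Finset.range (n + 1),
        if k ≤ y then iterProb n K p 0 c y else 0) = if k ≤ c then 1 else 0 := by
      intro c hc
      rw [Finset.sum_eq_single c]
      · simp [iterProb]
      · intro y _ hy
        simp [iterProb, hy.symm]
      · intro h
        simp at h
        omega
    rw [h a (by omega), h b hb]
    split_ifs <;> first | omega | norm_num
  | succ m ih =>
    intro a b hab
    induction b, hab using Nat.le_induction with
    | base => intro _; exact le_rfl
    | succ b hab ih2 =>
      intro hb
      refine (ih2 (by omega)).trans ?_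
      rw [tail_succ, tail_succ]
      exact step_mono n K p hp0 hp1 _ ih b hb

/-- For every `m ≥ 1` and every `k ∈ {0, ..., n}`, the `m`-step tail transition probability
`h_k^{(m)}(x) = P[X_{t+m} ≥ k ∣ X_t = x]` of the error Markov chain is nondecreasing in the
state `x` on `{0, ..., n}` (the chain is time-homogeneous, so this probability does not
depend on `t`). -/
theorem multi_step_tail_monotone (n K : ℕ) (hn : 0 < n) (p : ℝ) (hp0 : 0 < p) (hp1 : p < 1)
    (hK : K ≤ n) (m : ℕ) (hm : 1 ≤ m) (k : ℕ) (hk : k ≤ n)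
    (x x' : ℕ) (hxx' : x ≤ x') (hx' : x' ≤ n) :
    (∑ y ∈ Finset.range (n + 1), if k ≤ y then iterProb n K p m x y else 0) ≤
      ∑ y ∈ Finset.range (n + 1), if k ≤ y then iterProb n K p m x' y else 0 := by
  exact tail_mono n K p hp0 hp1 k m x x' hxx' hx'
end

section
/- Fix reals p, α, β with 0 < α < p < 1, 0 < β < 1 and β < (p−α)/p, set δ = (1/2)(p − α/(1−β)) and T = ⌈(log((p − α − pβ)/2) − log(p/2 − α + α/(2(1−β)))) / log(1 − p/2 − α/(2(1−β)))⌉ + 1. For each positive integer n let (X_t^{(n)})_{t≥0} be the error Markov chain with parameters n, p and correction capacity K_n, where (K_n) is any sequence of natural numbers with K_n ≤ nα. Then for every fixed integer t ≥ T, P[X_t^{(n)} > nβ] → 1 as n → ∞. -/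
lemma binomPMF_nonneg_s14 (m : ℕ) (p : ℝ) (h0 : 0 ≤ p) (h1 : p ≤ 1) (k : ℕ) :
    0 ≤ binomPMF m p k := by
  unfold binomPMF
  have : 0 ≤ 1 - p := by linarith
  positivity

lemma binomPMF_sum (m : ℕ) (p : ℝ) : ∑ k ∈ Finset.range (m + 1), binomPMF m p k = 1 := by
  have h := congrArg (Polynomial.eval p) (bernsteinPolynomial.sum ℝ m)
  simpa [Polynomial.eval_finsetSum, bernsteinPolynomial, binomPMF] using h

lemma binomPMF_var (m : ℕ) (p : ℝ) :
    ∑ k ∈ Finset.range (m + 1), (m * p - k) ^ 2 * binomPMF m p k = m * p * (1 - p) := by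
  have h := congrArg (Polynomial.eval p) (bernsteinPolynomial.variance ℝ m)
  simpa [Polynomial.eval_finsetSum, bernsteinPolynomial, binomPMF] using h

lemma binomPMF_cheb (m : ℕ) (p : ℝ) (h0 : 0 ≤ p) (h1 : p ≤ 1) (s : ℝ) (hs : 0 < s) :
    ∑ k ∈ Finset.range (m + 1), (if (k : ℝ) < m * p - s then binomPMF m p k else 0)
      ≤ m / s ^ 2 := by
  have hb := binomPMF_nonneg_s14 m p h0 h1
  have : ∑ k ∈ Finset.range (m + 1), (if (k : ℝ) < m * p - s then binomPMF m p k else 0)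
      ≤ ∑ k ∈ Finset.range (m + 1), ((m * p - k) ^ 2 * binomPMF m p k) / s ^ 2 := by
    apply Finset.sum_le_sum
    intro k _
    split_ifs with h
    · rw [le_div_iff₀ (by positivity), mul_comm]
      apply mul_le_mul_of_nonneg_right _ (hb k)
      apply pow_le_pow_left₀ hs.le
      linarith
    · have := hb k
      positivity
  rw [← Finset.sum_div, binomPMF_var] at this
  refine this.trans ?_
  gcongr
  have hm : (0 : ℝ) ≤ m := by positivity
  nlinarith [mul_nonneg hm h0, mul_nonneg hm (sub_nonneg.2 h1), mul_nonneg (mul_nonneg hm h0) h0]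

lemma step_sum (n K : ℕ) (p : ℝ) (x : ℕ) (hx : x ≤ n) (f : ℕ → ℝ) :
    ∑ z ∈ Finset.range (n + 1), stepProb n K p x z * f z =
      ∑ k ∈ Finset.range (n - x + 1), binomPMF (n - x) p k * f (x + k - min (x + k) K) := by
  unfold stepProb
  simp_rw [Finset.sum_mul]
  rw [Finset.sum_comm]
  apply Finset.sum_congr rfl
  intro k hk
  rw [Finset.mem_range] at hk
  simp_rw [ite_mul, zero_mul]
  rw [Finset.sum_ite_eq, if_pos]
  rw [Finset.mem_range]
  omega

noncomputable def hitProb (n K : ℕ) (p β : ℝ) (m x : ℕ) : ℝ :=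
  ∑ y ∈ Finset.range (n + 1), if (n : ℝ) * β < (y : ℝ) then iterProb n K p m x y else 0

lemma hitProb_succ (n K : ℕ) (p β : ℝ) (m x : ℕ) (hx : x ≤ n) :
    hitProb n K p β (m + 1) x =
      ∑ k ∈ Finset.range (n - x + 1), binomPMF (n - x) p k *
        hitProb n K p β m (x + k - min (x + k) K) := by
  rw [← step_sum n K p x hx (hitProb n K p β m)]
  unfold hitProb
  simp_rw [Finset.mul_sum]
  rw [Finset.sum_comm]
  apply Finset.sum_congr rfl
  intro y _
  split_ifs
  · rfl
  · simp

lemma hitProb_bounds (n K : ℕ) (p β : ℝ) (h0 : 0 ≤ p) (h1 : p ≤ 1) (m : ℕ) :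
    ∀ x ≤ n, 0 ≤ hitProb n K p β m x ∧ hitProb n K p β m x ≤ 1 := by
  induction m with
  | zero =>
    intro x hx
    have : hitProb n K p β 0 x = if (n : ℝ) * β < (x : ℝ) then 1 else 0 := by
      unfold hitProb iterProb
      rw [Finset.sum_eq_single x]
      · simp
      · intro b _ hb
        simp [hb.symm]
      · intro h
        exact absurd (Finset.mem_range.2 (by omega)) h
    rw [this]
    split_ifs <;> simp
  | succ m ih =>
    intro x hx
    rw [hitProb_succ n K p β m x hx]
    constructor
    · apply Finset.sum_nonneg
      intro k hk
      rw [Finset.mem_range] at hk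
      exact mul_nonneg (binomPMF_nonneg_s14 _ _ h0 h1 _) (ih _ (by omega)).1
    · rw [← binomPMF_sum (n - x) p]
      apply Finset.sum_le_sum
      intro k hk
      rw [Finset.mem_range] at hk
      exact mul_le_of_le_one_right (binomPMF_nonneg_s14 _ _ h0 h1 _) (ih _ (by omega)).2

lemma hitProb_lower (n K : ℕ) (p α β q ε : ℝ) (h0 : 0 ≤ p) (h1 : p ≤ 1) (hn : 0 < n)
    (hK : (K : ℝ) ≤ n * α) (hq0 : 0 < q) (hq1 : q ≤ 1) (hqp : q ≤ p)
    (hε : 0 < ε) (hε2 : ε * q ≤ α * (p - q)) (m : ℕ) :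
    ∀ (a : ℝ) (x : ℕ), x ≤ n → a * q ≤ q - α → n * a ≤ x →
      β < (fun a => (1 - q) * a + q - α)^[m] a →
      1 - m * (1 / (ε ^ 2 * n)) ≤ hitProb n K p β m x := by
  have hnR : (0 : ℝ) < n := by exact_mod_cast hn
  induction m with
  | zero =>
    intro a x hx ha hax hβ
    simp only [Function.iterate_zero, id] at hβ
    have hlt : (n : ℝ) * β < x := lt_of_lt_of_le (mul_lt_mul_of_pos_left hβ hnR) hax
    unfold hitProb iterProb
    rw [Finset.sum_eq_single x]
    · simp [hlt]
    · intro b _ hb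
      simp [hb.symm]
    · intro h
      exact absurd (Finset.mem_range.2 (by omega)) h
  | succ m ih =>
    intro a x hx ha hax hβ
    rw [Function.iterate_succ, Function.comp] at hβ
    set C := 1 / (ε ^ 2 * n) with hC
    have hC0 : 0 ≤ C := by positivity
    rw [hitProb_succ n K p β m x hx]
    set N := n - x with hN
    have hNR : (N : ℝ) = n - x := by rw [hN, Nat.cast_sub hx]
    have hb := binomPMF_nonneg_s14 N p h0 h1
    have hch := binomPMF_cheb N p h0 h1 (ε * n) (by positivity)
    have hNC : (N : ℝ) / (ε * n) ^ 2 ≤ C := by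
      rw [hC, div_le_div_iff₀ (by positivity) (by positivity)]
      have : (N : ℝ) ≤ n := by rw [hNR]; linarith [Nat.cast_nonneg (α := ℝ) x]
      nlinarith [mul_le_mul_of_nonneg_right this (by positivity : 0 ≤ ε ^ 2 * (n : ℝ))]
    have hεa : ε ≤ (1 - a) * (p - q) := by
      have : ε * q ≤ ((1 - a) * (p - q)) * q := by nlinarith
      exact le_of_mul_le_mul_right this hq0
    have key : ∑ k ∈ Finset.range (N + 1), (binomPMF N p k * (1 - m * C) -
        (if (k : ℝ) < N * p - ε * n then binomPMF N p k else 0)) ≤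
        ∑ k ∈ Finset.range (N + 1), binomPMF N p k *
          hitProb n K p β m (x + k - min (x + k) K) := by
      apply Finset.sum_le_sum
      intro k hk
      rw [Finset.mem_range] at hk
      have hle : x + k - min (x + k) K ≤ n := by omega
      split_ifs with h
      · have h2 := (hitProb_bounds n K p β h0 h1 m _ hle).1
        have h3 := mul_nonneg (hb k) h2
        have h4 : 0 ≤ binomPMF N p k * (m * C) := mul_nonneg (hb k) (by positivity)
        linarith
      · rw [sub_zero]
        apply mul_le_mul_of_nonneg_left _ (hb k)
        apply ih _ _ hle _ _ hβ
        · nlinarith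
        · have h5 : x + k ≤ (x + k - min (x + k) K) + K := by omega
          have h6 : (x : ℝ) + k ≤ ((x + k - min (x + k) K : ℕ) : ℝ) + K := by exact_mod_cast h5
          rw [hNR] at h
          have h7 : n * ε ≤ n * ((1 - a) * (p - q)) := mul_le_mul_of_nonneg_left hεa hnR.le
          have h8 : n * a * (1 - p) ≤ x * (1 - p) :=
            mul_le_mul_of_nonneg_right hax (by linarith)
          nlinarith
    refine le_trans ?_ key
    rw [Finset.sum_sub_distrib, ← Finset.sum_mul, binomPMF_sum]
    push_cast
    linarith

lemma iter_closed (q α : ℝ) (hq : q ≠ 0) (m : ℕ) :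
    (fun a => (1 - q) * a + q - α)^[m] 0 = (q - α) / q * (1 - (1 - q) ^ m) := by
  induction m with
  | zero => simp
  | succ m ih =>
    rw [Function.iterate_succ_apply', ih]
    field_simp
    ring

/-- Fix `0 < α < p < 1`, `0 < β < 1` with `β < (p−α)/p`, and set
`T = ⌈(log((p − α − pβ)/2) − log(p/2 − α + α/(2(1−β)))) / log(1 − p/2 − α/(2(1−β)))⌉ + 1`
(this corresponds to the choice `δ = (1/2)(p − α/(1−β))`). For each `n`, run the error
Markov chain with parameters `n`, `p` and correction capacity `K_n ≤ nα`. Then for every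
fixed `t ≥ T`, `P[X_t^{(n)} > nβ] → 1` as `n → ∞`. -/
theorem hitting_prob_tendsto_one (p α β : ℝ) (hα0 : 0 < α) (hαp : α < p) (hp1 : p < 1)
    (hβ0 : 0 < β) (hβ1 : β < 1) (hβ : β < (p - α) / p)
    (Kseq : ℕ → ℕ) (hK : ∀ n : ℕ, (Kseq n : ℝ) ≤ (n : ℝ) * α) :
    ∀ t : ℕ,
      (⌈(Real.log ((p - α - p * β) / 2) - Real.log (p / 2 - α + α / (2 * (1 - β)))) /
          Real.log (1 - p / 2 - α / (2 * (1 - β)))⌉ + 1 : ℤ) ≤ (t : ℤ) →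
      Filter.Tendsto
        (fun n : ℕ => ∑ y ∈ Finset.range (n + 1),
          if (n : ℝ) * β < (y : ℝ) then iterProb n (Kseq n) p t 0 y else 0)
        Filter.atTop (nhds 1) := by
  intro t ht
  have hp0 : 0 < p := hα0.trans hαp
  have hb1 : 0 < 1 - β := by linarith
  have hpb : β * p < p - α := (lt_div_iff₀ hp0).1 hβ
  obtain ⟨r, hr⟩ : ∃ r, r = α / (1 - β) := ⟨_, rfl⟩
  have hrb : r * (1 - β) = α := by rw [hr]; field_simp
  have hr2 : α / (2 * (1 - β)) = r / 2 := by rw [hr]; field_simp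
  have hrp : r < p := by
    rw [hr, div_lt_iff₀ hb1]; linarith
  have hr0 : 0 < r := by rw [hr]; positivity
  have hαr : α < r := by nlinarith
  rw [hr2] at ht
  obtain ⟨q, hq⟩ : ∃ q, q = p / 2 + r / 2 := ⟨_, rfl⟩
  have e1 : p / 2 - α + r / 2 = q - α := by rw [hq]; ring
  have e2 : 1 - p / 2 - r / 2 = 1 - q := by rw [hq]; ring
  have e3 : (p - α - p * β) / 2 = q * (1 - β) - α := by rw [hq]; linarith
  rw [e1, e2, e3] at ht
  have hq0 : 0 < q := by linarith
  have hq1 : q < 1 := by linarith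
  have hqp : q < p := by linarith
  have hqα : 0 < q - α := by linarith
  have hnum : 0 < q * (1 - β) - α := by rw [← e3]; linarith
  have hlog : Real.log (1 - q) < 0 := Real.log_neg (by linarith) (by linarith)
  have ht2 : (Real.log (q * (1 - β) - α) - Real.log (q - α)) / Real.log (1 - q) < t := by
    have h1 := Int.le_ceil ((Real.log (q * (1 - β) - α) - Real.log (q - α)) / Real.log (1 - q))
    have h2 : ((⌈(Real.log (q * (1 - β) - α) - Real.log (q - α)) / Real.log (1 - q)⌉ + 1 : ℤ) : ℝ)
      ≤ ((t : ℤ) : ℝ) := by exact_mod_cast ht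
    push_cast at h2
    linarith
  rw [div_lt_iff_of_neg hlog, ← Real.log_pow, ← Real.log_div hnum.ne' hqα.ne'] at ht2
  have hpow : (1 - q) ^ t < (q * (1 - β) - α) / (q - α) :=
    (Real.log_lt_log_iff (pow_pos (by linarith) _) (by positivity)).1 ht2
  rw [lt_div_iff₀ hqα] at hpow
  have hiter : β < (fun a => (1 - q) * a + q - α)^[t] 0 := by
    rw [iter_closed q α hq0.ne', div_mul_eq_mul_div, lt_div_iff₀ hq0]
    linarith
  obtain ⟨ε, hε⟩ : ∃ ε, ε = α * (p - q) / q := ⟨_, rfl⟩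
  have hε0 : 0 < ε := by
    rw [hε]; exact div_pos (mul_pos hα0 (by linarith)) hq0
  have hεq : ε * q ≤ α * (p - q) := by rw [hε]; field_simp; exact le_refl _
  change Filter.Tendsto (fun n : ℕ => hitProb n (Kseq n) p β t 0) Filter.atTop (nhds 1)
  have hlim : Filter.Tendsto (fun n : ℕ => 1 - (t : ℝ) * (1 / (ε ^ 2 * (n : ℝ))))
      Filter.atTop (nhds 1) := by
    have h1 : Filter.Tendsto (fun n : ℕ => ε ^ 2 * (n : ℝ)) Filter.atTop Filter.atTop :=
      Filter.Tendsto.const_mul_atTop (by positivity) tendsto_natCast_atTop_atTop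
    have h2 := (h1.inv_tendsto_atTop.const_mul (t : ℝ)).const_sub 1
    simpa using h2
  refine tendsto_of_tendsto_of_tendsto_of_le_of_le' hlim tendsto_const_nhds ?_ ?_
  · filter_upwards [Filter.eventually_gt_atTop 0] with n hn
    exact hitProb_lower n (Kseq n) p α β q ε hp0.le hp1.le hn (hK n) hq0 hq1.le hqp.le hε0 hεq t
      0 0 (Nat.zero_le _) (by linarith) (by simp) hiter
  · exact Filter.Eventually.of_forall fun n =>
      (hitProb_bounds n (Kseq n) p β hp0.le hp1.le t 0 (Nat.zero_le _)).2
end
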